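/- arXiv:1601.04614 — 2 statements merged into one kernel-verified Lean document; each statement's English description precedes it below -/
import Mathlib

section
/- Support theorem for the X-ray transform on the Euclidean plane: Let R > 0 and let f : ℝ² → ℝ be continuous such that for every k ∈ ℕ there is a constant C_k with |f(x)| ≤ C_k (1+|x|)^{-k} for all x ∈ ℝ². If ∫_{-∞}^{∞} f(x+sθ) ds = 0 for every x ∈ ℝ² and every unit vector θ ∈ ℝ² such that inf_{s∈ℝ} |x+sθ| > R (i.e. the line x+ℝθ has distance greater than R from the origin), then f(x) = 0 for all x with |x| > R. -/
open MeasureTheory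

section

open Set Filter Topology

/-- Continuous functions on `ℝ` that decay faster than any power of `t` as `t → ∞`. -/
structure RapidlyDecaying (w : ℝ → ℂ) : Prop where
  continuous : Continuous w
  decay : ∀ k : ℕ, ∃ C : ℝ, 0 ≤ C ∧ ∀ t, 0 ≤ t → ‖w t‖ ≤ C / (1 + t) ^ k

/-- The antiderivative of `-w` that vanishes at infinity. -/
noncomputable def tailIntegral (w : ℝ → ℂ) (t : ℝ) : ℂ := ∫ τ in Ioi t, w τ

namespace RapidlyDecaying

variable {w : ℝ → ℂ}

theorem integrableOn_Ioi (hw : RapidlyDecaying w) (a : ℝ) : IntegrableOn w (Ioi a) := by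
  have h0 : IntegrableOn w (Ioi 0) := by
    obtain ⟨C, hC, h⟩ := hw.decay 2
    refine Integrable.mono' ((integrable_inv_one_add_sq.const_mul C).integrableOn)
      hw.continuous.aestronglyMeasurable ?_
    filter_upwards [ae_restrict_mem measurableSet_Ioi] with t ht
    have ht : 0 < t := ht
    refine (h t ht.le).trans ?_
    rw [div_eq_mul_inv]
    gcongr
    nlinarith
  refine ((hw.continuous.integrableOn_Icc (a := a) (b := 0)).union h0).mono_set fun x hx => ?_
  rcases le_or_gt x 0 with h | h
  · exact Or.inl ⟨le_of_lt hx, h⟩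
  · exact Or.inr h

theorem hasDerivAt_tailIntegral (hw : RapidlyDecaying w) (t : ℝ) :
    HasDerivAt (tailIntegral w) (-w t) t := by
  have h : tailIntegral w = fun t => tailIntegral w 0 - ∫ τ in (0 : ℝ)..t, w τ := by
    ext t
    rw [tailIntegral, tailIntegral,
      ← intervalIntegral.integral_interval_add_Ioi (hw.integrableOn_Ioi 0) (hw.integrableOn_Ioi t)]
    ring
  rw [h]
  exact (hw.continuous.integral_hasStrictDerivAt 0 t).hasDerivAt.const_sub _

theorem rapidlyDecaying_tailIntegral (hw : RapidlyDecaying w) : RapidlyDecaying (tailIntegral w) := by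
  refine ⟨continuous_iff_continuousAt.2 fun t => (hw.hasDerivAt_tailIntegral t).continuousAt,
    fun k => ?_⟩
  obtain ⟨C, hC, h⟩ := hw.decay (k + 2)
  refine ⟨C * ∫ τ : ℝ, (1 + τ ^ 2)⁻¹,
    mul_nonneg hC (integral_nonneg fun τ => by positivity), fun t ht => ?_⟩
  have hint : Integrable fun τ : ℝ => C / (1 + t) ^ k * (1 + τ ^ 2)⁻¹ :=
    integrable_inv_one_add_sq.const_mul _
  calc ‖∫ τ in Ioi t, w τ‖ ≤ ∫ τ in Ioi t, C / (1 + t) ^ k * (1 + τ ^ 2)⁻¹ := by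
        refine norm_integral_le_of_norm_le hint.integrableOn ?_
        filter_upwards [ae_restrict_mem measurableSet_Ioi] with τ hτ
        have hτ : t < τ := hτ
        refine (h τ (by linarith)).trans ?_
        rw [pow_add, ← div_div, div_eq_mul_inv (C / (1 + τ) ^ k)]
        have : 0 < τ := by linarith
        gcongr
        nlinarith
    _ ≤ ∫ τ, C / (1 + t) ^ k * (1 + τ ^ 2)⁻¹ :=
        setIntegral_le_integral hint (Eventually.of_forall fun τ => by positivity)
    _ = _ := by rw [integral_const_mul]; ring

theorem exists_norm_mul_pow_le (hw : RapidlyDecaying w) (n : ℕ) :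
    ∃ C : ℝ, 0 ≤ C ∧ ∀ p s : ℝ, ‖w (p ^ 2 + s ^ 2)‖ * ‖(p + s * Complex.I : ℂ)‖ ^ n ≤
      C * ((1 + p ^ 2)⁻¹ * (1 + s ^ 2)⁻¹) := by
  obtain ⟨C, hC, h⟩ := hw.decay (n + 2)
  refine ⟨C, hC, fun p s => ?_⟩
  have hz : ‖(p + s * Complex.I : ℂ)‖ ≤ 1 + (p ^ 2 + s ^ 2) := by
    rw [Complex.norm_add_mul_I]
    refine Real.sqrt_le_iff.2 ⟨by positivity, ?_⟩
    nlinarith [sq_nonneg p, sq_nonneg s]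
  calc _ ≤ C / (1 + (p ^ 2 + s ^ 2)) ^ (n + 2) * (1 + (p ^ 2 + s ^ 2)) ^ n := by
        gcongr
        exact h _ (by positivity)
    _ = C * ((1 + (p ^ 2 + s ^ 2)) ^ 2)⁻¹ := by
        rw [pow_add]; field_simp
    _ ≤ _ := by
        rw [← mul_inv]
        gcongr
        nlinarith [sq_nonneg p, sq_nonneg s, mul_nonneg (sq_nonneg p) (sq_nonneg s),
          sq_nonneg (p ^ 2 + s ^ 2)]

theorem exists_norm_mul_pow_le_inv (hw : RapidlyDecaying w) (n : ℕ) :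
    ∃ C : ℝ, 0 ≤ C ∧ ∀ p s : ℝ, ‖w (p ^ 2 + s ^ 2)‖ * ‖(p + s * Complex.I : ℂ)‖ ^ n ≤
      C * (1 + s ^ 2)⁻¹ := by
  obtain ⟨C, hC, h⟩ := hw.exists_norm_mul_pow_le n
  refine ⟨C, hC, fun p s => (h p s).trans ?_⟩
  gcongr
  exact mul_le_of_le_one_left (by positivity) (inv_le_one_of_one_le₀ (by nlinarith [sq_nonneg p]))

theorem continuous_mul_pow (hw : RapidlyDecaying w) (n : ℕ) (p : ℝ) :
    Continuous fun s : ℝ => w (p ^ 2 + s ^ 2) * (p + s * Complex.I : ℂ) ^ n := by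
  have := hw.continuous
  fun_prop

theorem integrable_mul_pow (hw : RapidlyDecaying w) (n : ℕ) (p : ℝ) :
    Integrable fun s : ℝ => w (p ^ 2 + s ^ 2) * (p + s * Complex.I : ℂ) ^ n := by
  obtain ⟨C, hC, h⟩ := hw.exists_norm_mul_pow_le_inv n
  refine Integrable.mono' (integrable_inv_one_add_sq.const_mul C)
    (hw.continuous_mul_pow n p).aestronglyMeasurable (Eventually.of_forall fun s => ?_)
  rw [norm_mul, norm_pow]
  exact h p s

theorem tendsto_mul_pow (hw : RapidlyDecaying w) (n : ℕ) (p : ℝ) {l : Filter ℝ}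
    (hl : Tendsto (fun s : ℝ => s ^ 2) l atTop) :
    Tendsto (fun s : ℝ => w (p ^ 2 + s ^ 2) * (p + s * Complex.I : ℂ) ^ n) l (𝓝 0) := by
  obtain ⟨C, hC, h⟩ := hw.exists_norm_mul_pow_le_inv n
  refine squeeze_zero_norm (a := fun s => C * (1 + s ^ 2)⁻¹)
    (fun s => by rw [norm_mul, norm_pow]; exact h p s) ?_
  simpa using ((tendsto_atTop_add_const_left l 1 hl).inv_tendsto_atTop).const_mul C

theorem tendsto_integral_mul_pow (hw : RapidlyDecaying w) (n : ℕ) :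
    Tendsto (fun p : ℝ => ∫ s : ℝ, w (p ^ 2 + s ^ 2) * (p + s * Complex.I : ℂ) ^ n) atTop
      (𝓝 0) := by
  obtain ⟨C, hC, h⟩ := hw.exists_norm_mul_pow_le n
  refine squeeze_zero_norm (a := fun p => (1 + p ^ 2)⁻¹ * ∫ s : ℝ, C * (1 + s ^ 2)⁻¹)
    (fun p => ?_) ?_
  · rw [← integral_const_mul]
    refine norm_integral_le_of_norm_le
      ((integrable_inv_one_add_sq.const_mul C).const_mul _) (Eventually.of_forall fun s => ?_)
    rw [norm_mul, norm_pow]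
    exact (h p s).trans_eq (by ring)
  · simpa using ((tendsto_atTop_add_const_left atTop 1
      (tendsto_pow_atTop two_ne_zero)).inv_tendsto_atTop).mul_const
        (∫ s : ℝ, C * (1 + s ^ 2)⁻¹)

/-- The derivative of `V(|z|²) zⁿ` along a curve, where `V` is the tail integral of `w`. -/
theorem hasDerivAt_tailIntegral_mul_pow (hw : RapidlyDecaying w) (n : ℕ) {ρ : ℝ → ℝ} {z : ℝ → ℂ}
    {ρ' t : ℝ} {c : ℂ} (hρ : HasDerivAt ρ ρ' t) (hz : HasDerivAt z c t) :
    HasDerivAt (fun t => tailIntegral w (ρ t) * z t ^ n)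
      (-(ρ' * w (ρ t) * z t ^ n) + n * (tailIntegral w (ρ t) * z t ^ (n - 1)) * c) t := by
  convert! (((hw.hasDerivAt_tailIntegral (ρ t)).scomp t hρ).mul (hz.pow n)) using 1
  simp only [Complex.real_smul, Function.comp, Pi.pow_apply]
  ring

theorem integral_tailIntegral_mul_pow_eq_zero (hw : RapidlyDecaying w) (n : ℕ) {R : ℝ}
    (h : ∀ p > R, ∫ s : ℝ, w (p ^ 2 + s ^ 2) * (p + s * Complex.I : ℂ) ^ (n + 1) = 0) :
    ∀ p > R, ∫ s : ℝ, tailIntegral w (p ^ 2 + s ^ 2) * (p + s * Complex.I : ℂ) ^ n = 0 := by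
  set V := tailIntegral w
  have hVr : RapidlyDecaying V := hw.rapidlyDecaying_tailIntegral
  have hVc := hVr.continuous
  have hwc := hw.continuous
  let D (c : ℂ) (x p s : ℝ) : ℂ := -((2 * x : ℝ) * w (p ^ 2 + s ^ 2) * (p + s * Complex.I) ^ n) +
    n * (V (p ^ 2 + s ^ 2) * (p + s * Complex.I) ^ (n - 1)) * c
  have hDp (p s : ℝ) : HasDerivAt (fun p : ℝ => V (p ^ 2 + s ^ 2) * (p + s * Complex.I : ℂ) ^ n)
      (D 1 p p s) p := by
    refine hw.hasDerivAt_tailIntegral_mul_pow n ?_ ?_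
    · simpa using (hasDerivAt_pow 2 p).add_const (s ^ 2)
    · exact (HasDerivAt.ofReal_comp (hasDerivAt_id p)).add_const _
  have hDs (p s : ℝ) : HasDerivAt (fun s : ℝ => V (p ^ 2 + s ^ 2) * (p + s * Complex.I : ℂ) ^ n)
      (D Complex.I s p s) s := by
    refine hw.hasDerivAt_tailIntegral_mul_pow n ?_ ?_
    · simpa using (hasDerivAt_pow 2 s).const_add (p ^ 2)
    · simpa using ((HasDerivAt.ofReal_comp (hasDerivAt_id s)).mul_const Complex.I).const_add (p : ℂ)
  obtain ⟨C₁, hC₁, h₁⟩ := hw.exists_norm_mul_pow_le_inv (n + 1)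
  obtain ⟨C₂, hC₂, h₂⟩ := hVr.exists_norm_mul_pow_le_inv (n - 1)
  have hbound (c : ℂ) (hc : ‖c‖ = 1) (x p s : ℝ) (hx : |x| ≤ ‖(p + s * Complex.I : ℂ)‖) :
      ‖D c x p s‖ ≤ (2 * C₁ + n * C₂) * (1 + s ^ 2)⁻¹ := by
    refine (norm_add_le _ _).trans ?_
    rw [norm_neg, norm_mul, norm_mul, norm_mul, norm_mul, norm_mul, hc, norm_pow, norm_pow,
      Complex.norm_real, Real.norm_eq_abs, abs_mul, abs_two, Complex.norm_natCast, add_mul]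
    have e₁ := h₁ p s
    have e₂ := mul_le_mul_of_nonneg_left (h₂ p s) (Nat.cast_nonneg (α := ℝ) n)
    rw [pow_succ _ n] at e₁
    have e₃ : |x| * (‖w (p ^ 2 + s ^ 2)‖ * ‖(p + s * Complex.I : ℂ)‖ ^ n) ≤
      ‖(p + s * Complex.I : ℂ)‖ * (‖w (p ^ 2 + s ^ 2)‖ * ‖(p + s * Complex.I : ℂ)‖ ^ n) := by gcongr
    linarith
  have hbd : Integrable fun s : ℝ => (2 * C₁ + n * C₂) * (1 + s ^ 2)⁻¹ :=
    integrable_inv_one_add_sq.const_mul _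
  have hxp (p s : ℝ) : |p| ≤ ‖(p + s * Complex.I : ℂ)‖ := by
    simpa using Complex.abs_re_le_norm (p + s * Complex.I : ℂ)
  have hxs (p s : ℝ) : |s| ≤ ‖(p + s * Complex.I : ℂ)‖ := by
    simpa using Complex.abs_im_le_norm (p + s * Complex.I : ℂ)
  have hDpc (p : ℝ) : Continuous (D 1 p p) := by fun_prop
  have hDsc (p : ℝ) : Continuous fun s => D Complex.I s p s := by fun_prop
  have hderiv (p : ℝ) := hasDerivAt_integral_of_dominated_loc_of_deriv_le
    (F := fun p s : ℝ => V (p ^ 2 + s ^ 2) * (p + s * Complex.I : ℂ) ^ n)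
    (F' := fun p s => D 1 p p s) (x₀ := p) (μ := volume) univ_mem
    (Eventually.of_forall fun p => (hVr.continuous_mul_pow n p).aestronglyMeasurable)
    (hVr.integrable_mul_pow n p) (hDpc p).aestronglyMeasurable
    (Eventually.of_forall fun s p _ => hbound 1 (by simp) p p s (hxp p s)) hbd
    (Eventually.of_forall fun s p _ => hDp p s)
  have hDsi (p : ℝ) : Integrable fun s => D Complex.I s p s :=
    hbd.mono' (hDsc p).aestronglyMeasurable
      (Eventually.of_forall fun s => hbound _ (by simp) s p s (hxs p s))
  have hDs0 (p : ℝ) : ∫ s, D Complex.I s p s = 0 := by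
    rw [integral_of_hasDerivAt_of_tendsto (hDs p) (hDsi p)
      (hVr.tendsto_mul_pow n p ?_) (hVr.tendsto_mul_pow n p (tendsto_pow_atTop two_ne_zero)),
      sub_zero]
    simpa [Function.comp_def] using
      (tendsto_pow_atTop (α := ℝ) two_ne_zero).comp tendsto_abs_atBot_atTop
  have hDp0 (p : ℝ) (hp : p > R) : ∫ s, D 1 p p s = 0 := by
    have key : ∀ s, D 1 p p s = -2 * (w (p ^ 2 + s ^ 2) * (p + s * Complex.I : ℂ) ^ (n + 1)) -
        Complex.I * D Complex.I s p s := by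
      intro s
      simp only [D]
      push_cast
      linear_combination (n * (V (p ^ 2 + s ^ 2) * (p + s * Complex.I) ^ (n - 1))) * Complex.I_sq
    simp_rw [key]
    rw [integral_sub ((hw.integrable_mul_pow _ p).const_mul _) ((hDsi p).const_mul _),
      integral_const_mul, integral_const_mul, h p hp, hDs0]
    simp
  intro p hp
  refine tendsto_nhds_unique (tendsto_const_nhds.congr' ?_) (hVr.tendsto_integral_mul_pow n)
  filter_upwards [eventually_gt_atTop R] with q hq
  refine isOpen_Ioi.is_const_of_deriv_eq_zero (𝕜 := ℝ)
    (f := fun p : ℝ => ∫ s : ℝ, V (p ^ 2 + s ^ 2) * (p + s * Complex.I : ℂ) ^ n)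
    isPreconnected_Ioi
    (fun x _ => (hderiv x).2.differentiableAt.differentiableWithinAt) (fun x hx => ?_)
    (mem_Ioi.2 hp) (mem_Ioi.2 hq)
  rw [(hderiv x).2.deriv, hDp0 x hx, Pi.zero_apply]

theorem eq_zero_of_tailIntegral_eq_zero (hw : RapidlyDecaying w) {T : ℝ}
    (h : ∀ t > T, tailIntegral w t = 0) : ∀ t > T, w t = 0 := by
  intro t ht
  have h0 : HasDerivAt (tailIntegral w) 0 t :=
    (hasDerivAt_const t (0 : ℂ)).congr_of_eventuallyEq <| by
      filter_upwards [Ioi_mem_nhds ht] with x hx using h x hx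
  exact neg_eq_zero.1 ((hw.hasDerivAt_tailIntegral t).unique h0)

theorem tendsto_atTop (hw : RapidlyDecaying w) : Tendsto w atTop (𝓝 0) := by
  obtain ⟨C, -, h⟩ := hw.decay 1
  refine squeeze_zero_norm' (a := fun t => C / (1 + t)) ?_ ?_
  · filter_upwards [eventually_ge_atTop 0] with t ht
    simpa using h t ht
  · exact (tendsto_atTop_add_const_left atTop 1 tendsto_id).const_div_atTop C

/-- Injectivity of the X-ray transform on radial functions. -/
theorem eq_zero_of_integral_eq_zero (hw : RapidlyDecaying w) {R : ℝ} (hR : 0 < R)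
    (h : ∀ p > R, ∫ s : ℝ, w (p ^ 2 + s ^ 2) = 0) : ∀ t > R ^ 2, w t = 0 := by
  refine hw.eq_zero_of_tailIntegral_eq_zero fun T hT => ?_
  have hwc := hw.continuous
  have hT0 : 0 < T := (sq_nonneg R).trans_lt hT
  have hint : Integrable (fun x : ℝ × ℝ => w (T + (x.1 ^ 2 + x.2 ^ 2))) (volume.prod volume) := by
    obtain ⟨C, hC, hb⟩ := hw.decay 2
    refine ((integrable_inv_one_add_sq.mul_prod integrable_inv_one_add_sq).const_mul C).mono'
      (by fun_prop) (Eventually.of_forall fun ⟨x, y⟩ => (hb _ (by positivity)).trans ?_)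
    rw [← mul_inv, div_eq_mul_inv]
    dsimp only
    gcongr
    nlinarith [sq_nonneg x, sq_nonneg y, mul_nonneg (sq_nonneg x) (sq_nonneg y),
      sq_nonneg (x ^ 2 + y ^ 2), mul_nonneg hT0.le (sq_nonneg x), mul_nonneg hT0.le (sq_nonneg y)]
  have hprod : ∫ x : ℝ × ℝ, w (T + (x.1 ^ 2 + x.2 ^ 2)) = 0 := by
    rw [Measure.volume_eq_prod, integral_prod _ hint]
    refine integral_eq_zero_of_ae (Eventually.of_forall fun x => ?_)
    have := h (√(T + x ^ 2)) (Real.lt_sqrt_of_sq_lt (by nlinarith [sq_nonneg x]))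
    rw [Real.sq_sqrt (by positivity)] at this
    simpa [add_assoc] using this
  have hcomplex : ∫ z : ℂ, w (T + ‖z‖ ^ 2) = 0 := by
    rw [← hprod, ← Complex.volume_preserving_equiv_real_prod.integral_comp'
      (fun x : ℝ × ℝ => w (T + (x.1 ^ 2 + x.2 ^ 2)))]
    simp [Complex.sq_norm, Complex.normSq_apply, ← sq]
  have hpolar : ∫ r in Ioi (0 : ℝ), r • w (T + r ^ 2) = 0 := by
    have := integral_fun_norm_addHaar (volume : Measure ℂ) fun r => w (T + r ^ 2)
    rw [hcomplex] at this
    have hball : (volume : Measure ℂ).real (Metric.ball 0 1) ≠ 0 :=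
      (ENNReal.toReal_pos (Metric.measure_ball_pos _ _ one_pos).ne'
        measure_ball_lt_top.ne).ne'
    simpa [Complex.finrank_real_complex, hball] using this
  have hsq : Tendsto (fun r : ℝ => T + r ^ 2) atTop atTop :=
    tendsto_atTop_add_const_left _ _ (tendsto_pow_atTop two_ne_zero)
  have hder (r : ℝ) : HasDerivAt (fun r => tailIntegral w (T + r ^ 2))
      (-2 * (r • w (T + r ^ 2))) r := by
    have : HasDerivAt (fun r : ℝ => T + r ^ 2) (2 * r) r := by
      simpa using (hasDerivAt_pow 2 r).const_add T
    convert! (hw.hasDerivAt_tailIntegral (T + r ^ 2)).scomp r this using 1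
    simp only [Complex.real_smul]
    push_cast
    ring
  have hI : IntegrableOn (fun r : ℝ => -2 * (r • w (T + r ^ 2))) (Ioi 0) := by
    obtain ⟨C, hC, hb⟩ := hw.decay 2
    refine Integrable.const_mul ?_ _
    refine ((integrable_inv_one_add_sq.const_mul C).integrableOn).mono'
      (by fun_prop) ?_
    filter_upwards [ae_restrict_mem measurableSet_Ioi] with r hr
    have hr : 0 < r := hr
    rw [norm_smul, Real.norm_of_nonneg hr.le]
    calc r * ‖w (T + r ^ 2)‖ ≤ (1 + r ^ 2) * (C / (1 + r ^ 2) ^ 2) := by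
          gcongr
          · nlinarith [sq_nonneg (r - 1)]
          · refine (hb _ (by positivity)).trans ?_
            gcongr
            linarith
      _ = _ := by field_simp
  have := integral_Ioi_of_hasDerivAt_of_tendsto (hder 0).continuousAt.continuousWithinAt
    (fun r _ => hder r) hI (hw.rapidlyDecaying_tailIntegral.tendsto_atTop.comp hsq)
  rw [integral_const_mul, hpolar] at this
  simpa using this

/-- Injectivity of the X-ray transform on functions of the form `w(|z|²) zⁿ`. -/
theorem eq_zero_of_integral_mul_pow_eq_zero {R : ℝ} (hR : 0 < R) (n : ℕ)
    (hw : RapidlyDecaying w)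
    (h : ∀ p > R, ∫ s : ℝ, w (p ^ 2 + s ^ 2) * (p + s * Complex.I : ℂ) ^ n = 0) :
    ∀ t > R ^ 2, w t = 0 := by
  induction n generalizing w with
  | zero => exact hw.eq_zero_of_integral_eq_zero hR (by simpa using h)
  | succ n ih =>
    exact hw.eq_zero_of_tailIntegral_eq_zero
      (ih hw.rapidlyDecaying_tailIntegral (hw.integral_tailIntegral_mul_pow_eq_zero n h))

end RapidlyDecaying

/-- The `n`-th Fourier coefficient of `g` along the circle through `z` centred at the origin. -/
noncomputable def angularCoeff (g : ℂ → ℂ) (n : ℤ) (z : ℂ) : ℂ :=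
  fourierCoeff (fun α : UnitAddCircle => g (fourier 1 α * z)) n

theorem norm_fourier_apply {T : ℝ} (n : ℤ) (α : AddCircle T) : ‖fourier n α‖ = 1 := by
  rw [fourier_apply]
  exact Circle.norm_coe _

theorem exists_fourier_one_eq {c : ℂ} (hc : ‖c‖ = 1) : ∃ α : UnitAddCircle, fourier 1 α = c := by
  obtain ⟨α, hα⟩ := (AddCircle.homeomorphCircle (one_ne_zero (α := ℝ))).surjective
    ⟨c, mem_sphere_zero_iff_norm.2 hc⟩
  refine ⟨α, ?_⟩
  rw [AddCircle.homeomorphCircle_apply] at hα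
  rw [fourier_one, hα]

theorem fourier_eq_fourier_one_pow {T : ℝ} (n : ℕ) (α : AddCircle T) :
    fourier (n : ℤ) α = fourier 1 α ^ n := by
  induction n with
  | zero => simp
  | succ n ih => rw [Nat.cast_succ, fourier_add, ih, pow_succ]

section angularCoeff

variable {g : ℂ → ℂ}

theorem continuous_angularCoeff (hg : Continuous g) (n : ℤ) : Continuous (angularCoeff g n) := by
  have := continuous_parametric_integral_of_continuous (μ := AddCircle.haarAddCircle)
    (f := fun (z : ℂ) (α : UnitAddCircle) => fourier (-n) α • g (fourier 1 α * z))
    (by fun_prop) (isCompact_univ (X := UnitAddCircle))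
  rw [Measure.restrict_univ] at this
  exact this

theorem norm_angularCoeff_le {n : ℤ} {z : ℂ} {B : ℝ} (h : ∀ c : ℂ, ‖c‖ = 1 → ‖g (c * z)‖ ≤ B) :
    ‖angularCoeff g n z‖ ≤ B := by
  refine (norm_integral_le_of_norm_le_const (C := B) (Eventually.of_forall fun α => ?_)).trans ?_
  · rw [norm_smul, norm_fourier_apply, one_mul]
    exact h _ (norm_fourier_apply 1 α)
  · simp

theorem angularCoeff_fourier_one_mul (n : ℤ) (β : UnitAddCircle) (z : ℂ) :
    angularCoeff g n (fourier 1 β * z) = fourier n β * angularCoeff g n z := by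
  have hβ : fourier n β * fourier (-n) β = 1 := by rw [← fourier_add]; simp
  have hadd (m : ℤ) (α : UnitAddCircle) : fourier m (α + β) = fourier m α * fourier m β := by
    simp [fourier_apply, smul_add, AddCircle.toCircle_add]
  unfold angularCoeff fourierCoeff
  rw [← integral_add_right_eq_self
      (fun α : UnitAddCircle => fourier (-n) α • g (fourier 1 α * z)) β,
    ← integral_const_mul]
  congr 1 with α
  rw [hadd, hadd, smul_eq_mul, smul_eq_mul]
  rw [show fourier n β * (fourier (-n) α * fourier (-n) β * g (fourier 1 α * fourier 1 β * z)) =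
    (fourier n β * fourier (-n) β) * (fourier (-n) α * g (fourier 1 α * fourier 1 β * z)) by ring,
    hβ, one_mul, mul_assoc (fourier 1 α)]

theorem angularCoeff_eq (n : ℕ) {z : ℂ} (hz : z ≠ 0) :
    angularCoeff g n z = angularCoeff g n ‖z‖ / (‖z‖ : ℂ) ^ n * z ^ n := by
  have hz' : (‖z‖ : ℂ) ≠ 0 := by simpa using hz
  obtain ⟨β, hβ⟩ := exists_fourier_one_eq (c := z / ‖z‖) (by simp [hz])
  have h := angularCoeff_fourier_one_mul (g := g) n β ‖z‖
  rw [fourier_eq_fourier_one_pow, hβ, div_mul_cancel₀ _ hz'] at h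
  rw [h, div_pow]
  field_simp

theorem integral_angularCoeff_eq_zero (hg : Continuous g)
    (hdecay : ∃ C : ℝ, ∀ z, ‖g z‖ ≤ C / (1 + ‖z‖) ^ 2) {p : ℝ}
    (h : ∀ c : ℂ, ‖c‖ = 1 → ∫ s : ℝ, g (c * (p + s * Complex.I)) = 0) (n : ℤ) :
    ∫ s : ℝ, angularCoeff g n (p + s * Complex.I) = 0 := by
  obtain ⟨C, hC⟩ := hdecay
  have hC0 : 0 ≤ C := by simpa using (norm_nonneg _).trans (hC 0)
  have hint : Integrable (Function.uncurry fun (s : ℝ) (α : UnitAddCircle) =>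
      fourier (-n) α • g (fourier 1 α * (p + s * Complex.I)))
      (volume.prod AddCircle.haarAddCircle) := by
    refine ((integrable_inv_one_add_sq.mul_prod
      (integrable_const (1 : ℝ))).const_mul C).mono' ?_ (Eventually.of_forall fun ⟨s, α⟩ => ?_)
    · refine Continuous.aestronglyMeasurable ?_
      unfold Function.uncurry
      fun_prop
    · simp only [Function.uncurry, norm_smul, norm_fourier_apply, one_mul, mul_one]
      refine (hC _).trans ?_
      rw [norm_mul, norm_fourier_apply, one_mul, div_eq_mul_inv]
      have hs : |s| ≤ ‖(p + s * Complex.I : ℂ)‖ := by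
        simpa using Complex.abs_im_le_norm (p + s * Complex.I : ℂ)
      gcongr
      nlinarith [abs_nonneg s, sq_abs s]
  unfold angularCoeff fourierCoeff
  rw [integral_integral_swap hint]
  refine integral_eq_zero_of_ae (Eventually.of_forall fun α => ?_)
  simp only [smul_eq_mul, integral_const_mul, h _ (norm_fourier_apply 1 α), mul_zero,
    Pi.zero_apply]

/-- If the X-ray transform of `g` vanishes on all lines at distance greater than `R` from the
origin, then so do the Fourier coefficients of `g` of nonnegative order along all circles of radius
greater than `R`. -/
theorem angularCoeff_eq_zero {R : ℝ} (hR : 0 < R) (hg : Continuous g)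
    (hdecay : ∀ k : ℕ, ∃ C : ℝ, ∀ z, ‖g z‖ ≤ C / (1 + ‖z‖) ^ k)
    (h : ∀ p > R, ∀ c : ℂ, ‖c‖ = 1 → ∫ s : ℝ, g (c * (p + s * Complex.I)) = 0)
    (n : ℕ) {r : ℝ} (hr : R < r) : angularCoeff g n r = 0 := by
  let ρ (t : ℝ) : ℝ := √(max t (R ^ 2))
  have hRρ (t : ℝ) : R ≤ ρ t := Real.le_sqrt_of_sq_le (le_max_right _ _)
  have hρ {t : ℝ} (ht : R ^ 2 ≤ t) : ρ t = √t := by simp [ρ, ht]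
  have hρ0 (t : ℝ) : (ρ t : ℂ) ^ n ≠ 0 :=
    pow_ne_zero _ (Complex.ofReal_ne_zero.2 (hR.trans_le (hRρ t)).ne')
  have hρc : Continuous ρ := by fun_prop
  let w (t : ℝ) : ℂ := angularCoeff g n (ρ t) / (ρ t : ℂ) ^ n
  have hw : RapidlyDecaying w := by
    refine ⟨Continuous.div ((continuous_angularCoeff hg n).comp (by fun_prop)) (by fun_prop) hρ0,
      fun k => ?_⟩
    obtain ⟨C, hC⟩ := hdecay (2 * k)
    have hC0 : 0 ≤ C := by simpa using (norm_nonneg _).trans (hC 0)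
    refine ⟨C / R ^ n, by positivity, fun t ht => ?_⟩
    have hρt : 1 + t ≤ (1 + ρ t) ^ 2 := by
      have : t ≤ ρ t ^ 2 := by
        rw [Real.sq_sqrt (ht.trans (le_max_left _ _))]
        exact le_max_left _ _
      nlinarith [hRρ t]
    have hnorm : ‖angularCoeff g n (ρ t)‖ ≤ C / (1 + t) ^ k := by
      refine norm_angularCoeff_le fun c hc => (hC _).trans ?_
      rw [norm_mul, hc, one_mul, Complex.norm_real, Real.norm_of_nonneg (hR.le.trans (hRρ t)),
        pow_mul]
      gcongr
    calc ‖w t‖ = ‖angularCoeff g n (ρ t)‖ / ρ t ^ n := by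
          rw [norm_div, norm_pow, Complex.norm_real, Real.norm_of_nonneg (hR.le.trans (hRρ t))]
      _ ≤ C / (1 + t) ^ k / R ^ n := by
          gcongr
          exact hRρ t
      _ = _ := by rw [div_right_comm]
  have hw0 : w (r ^ 2) = 0 := by
    refine hw.eq_zero_of_integral_mul_pow_eq_zero hR n (fun p hp => ?_) _ (by gcongr)
    rw [← integral_angularCoeff_eq_zero hg (hdecay 2) (h p hp) n]
    congr 1 with s
    have hz : (p + s * Complex.I : ℂ) ≠ 0 := fun h0 => by
      have := congrArg Complex.re h0
      simp at this
      linarith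
    rw [angularCoeff_eq n hz, Complex.norm_add_mul_I]
    simp only [w, hρ (show R ^ 2 ≤ p ^ 2 + s ^ 2 by nlinarith [sq_nonneg s])]
  have hρr : ρ (r ^ 2) = r := by
    rw [hρ (by gcongr), Real.sqrt_sq (hR.trans hr).le]
  exact hρr ▸ (div_eq_zero_iff.1 hw0).resolve_right (hρ0 _)

theorem angularCoeff_neg (hg : ∀ z, (starRingEnd ℂ) (g z) = g z) (n : ℤ) (z : ℂ) :
    angularCoeff g (-n) z = (starRingEnd ℂ) (angularCoeff g n z) := by
  unfold angularCoeff fourierCoeff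
  rw [← integral_conj]
  congr 1 with α
  rw [smul_eq_mul, smul_eq_mul, map_mul, hg, fourier_neg]

theorem eq_zero_of_angularCoeff_eq_zero (hg : Continuous g) {z : ℂ}
    (h : ∀ n : ℤ, angularCoeff g n ‖z‖ = 0) : g z = 0 := by
  let G : C(UnitAddCircle, ℂ) := ⟨fun α => g (fourier 1 α * ‖z‖), by fun_prop⟩
  have hG : fourierCoeff G = 0 := funext h
  obtain ⟨α, hα⟩ : ∃ α : UnitAddCircle, fourier 1 α * (‖z‖ : ℂ) = z := by
    rcases eq_or_ne z 0 with rfl | hz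
    · exact ⟨0, by simp⟩
    · obtain ⟨α, hα⟩ := exists_fourier_one_eq (c := z / ‖z‖) (by simp [hz])
      exact ⟨α, by rw [hα, div_mul_cancel₀ _ (by simpa using hz)]⟩
  have := has_pointwise_sum_fourier_series_of_summable (f := G) (hG ▸ summable_zero) α
  simp only [hG, Pi.zero_apply, zero_smul] at this
  have hGα : G α = g z := congrArg g hα
  exact hGα ▸ this.unique hasSum_zero

end angularCoeff

end

/-- **Support theorem for the X-ray transform on the Euclidean plane.**
If `f : ℝ² → ℝ` is continuous with rapid decay (for every `k` there is `C_k` with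
`|f x| ≤ C_k / (1 + ‖x‖)^k`), and the X-ray transform of `f` vanishes on every line
`x + ℝθ` whose distance `⨅ s, ‖x + s • θ‖` from the origin exceeds `R > 0`,
then `f` vanishes outside the closed ball of radius `R` around the origin. -/
theorem xray_support_theorem_euclidean_plane
    (R : ℝ) (hR : 0 < R)
    (f : EuclideanSpace ℝ (Fin 2) → ℝ)
    (hf : Continuous f)
    (hdecay : ∀ k : ℕ, ∃ C : ℝ, ∀ x : EuclideanSpace ℝ (Fin 2),
      |f x| ≤ C / (1 + ‖x‖) ^ k)
    (hvanish : ∀ (x θ : EuclideanSpace ℝ (Fin 2)), ‖θ‖ = 1 →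
      R < ⨅ s : ℝ, ‖x + s • θ‖ → ∫ s : ℝ, f (x + s • θ) = 0) :
    ∀ x : EuclideanSpace ℝ (Fin 2), R < ‖x‖ → f x = 0 := by
  let L := Complex.orthonormalBasisOneI.repr
  let g (z : ℂ) : ℂ := f (L z)
  have hg : Continuous g := by fun_prop
  have hgdecay (k : ℕ) : ∃ C : ℝ, ∀ z, ‖g z‖ ≤ C / (1 + ‖z‖) ^ k := by
    obtain ⟨C, hC⟩ := hdecay k
    refine ⟨C, fun z => ?_⟩
    simpa [g] using hC (L z)
  have hline (p : ℝ) (hp : p > R) (c : ℂ) (hc : ‖c‖ = 1) :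
      ∫ s : ℝ, g (c * (p + s * Complex.I)) = 0 := by
    have hL (s : ℝ) : L (c * (p + s * Complex.I)) = L (c * p) + s • L (c * Complex.I) := by
      rw [← map_smul, ← map_add, Complex.real_smul]
      congr 1
      ring
    have hinf : R < ⨅ s : ℝ, ‖L (c * p) + s • L (c * Complex.I)‖ := by
      refine hp.trans_le (le_ciInf fun s => ?_)
      rw [← hL, L.norm_map, norm_mul, hc, one_mul]
      have := Complex.abs_re_le_norm (p + s * Complex.I : ℂ)
      exact (le_abs_self p).trans (by simpa using this)
    have h0 := hvanish _ _ (by simp [L.norm_map, hc]) hinf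
    simp only [g, hL]
    rw [integral_complex_ofReal, h0, Complex.ofReal_zero]
  intro x hx
  have hx' : R < ‖L.symm x‖ := by rwa [L.symm.norm_map]
  have hgx : g (L.symm x) = 0 := by
    refine eq_zero_of_angularCoeff_eq_zero hg fun n => ?_
    obtain ⟨m, rfl | rfl⟩ := n.eq_nat_or_neg
    · exact angularCoeff_eq_zero hR hg hgdecay hline m hx'
    · rw [angularCoeff_neg (fun z => Complex.conj_ofReal _),
        angularCoeff_eq_zero hR hg hgdecay hline m hx', map_zero]
  simpa [g] using hgx
end

section
/- Support theorem on ℝ² for general compact sets: Let K₀ ⊂ ℝ² be compact and let f : ℝ² → ℝ be continuous such that for every k ∈ ℕ there is a constant C_k with |f(x)| ≤ C_k (1+|x|)^{-k} for all x. If ∫_{-∞}^{∞} f(x+sθ) ds = 0 for every x ∈ ℝ² and unit vector θ such that the line x+ℝθ is disjoint from K₀, then f vanishes on the complement of the convex hull of K₀. -/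
open MeasureTheory

/-- A continuous function on the plane decaying faster than any power of the modulus. -/
def RapidDecay (g : ℂ → ℝ) : Prop :=
  Continuous g ∧ ∀ k : ℕ, ∃ C : ℝ, ∀ z, |g z| * (1 + ‖z‖) ^ k ≤ C

/-- `g` is orthogonal to every radial truncated power that vanishes on a disc around `w`
containing the disc of radius `R` around the origin. -/
def OrthogonalToExteriorPowers (R : ℝ) (g : ℂ → ℝ) : Prop :=
  ∀ (w : ℂ) (n : ℕ) (A : ℝ), 2 ≤ n → (R + ‖w‖) ^ 2 < A →
    ∫ z, g z * √(‖z - w‖ ^ 2 - A) ^ n = 0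

namespace RapidDecay

variable {g h : ℂ → ℝ}

lemma integrable_mul_pow (hg : RapidDecay g) (k : ℕ) :
    Integrable (fun z => |g z| * (1 + ‖z‖) ^ k) := by
  obtain ⟨C, hC⟩ := hg.2 (k + 3)
  have hint : Integrable (fun z : ℂ => C * (1 + ‖z‖) ^ (-(3 : ℝ))) :=
    (integrable_one_add_norm (by norm_num)).const_mul C
  have := hg.1
  refine hint.mono' (by fun_prop) (.of_forall fun z => ?_)
  have hz : 0 < 1 + ‖z‖ := by positivity
  rw [Real.norm_of_nonneg (by positivity), Real.rpow_neg hz.le, ← div_eq_mul_inv,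
    le_div_iff₀ (by positivity)]
  calc _ = |g z| * (1 + ‖z‖) ^ (k + 3) := by norm_cast; ring
    _ ≤ C := hC z

lemma integrable_mul (hg : RapidDecay g) {φ : ℂ → ℝ} (hφ : Continuous φ) {C : ℝ} {k : ℕ}
    (hbd : ∀ z, |φ z| ≤ C * (1 + ‖z‖) ^ k) : Integrable (fun z => g z * φ z) := by
  refine ((hg.integrable_mul_pow k).const_mul C).mono' (hg.1.mul hφ).aestronglyMeasurable
    (.of_forall fun z => ?_)
  rw [Real.norm_eq_abs, abs_mul]
  calc |g z| * |φ z| ≤ |g z| * (C * (1 + ‖z‖) ^ k) := by gcongr; exact hbd z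
    _ = _ := by ring

lemma add (hg : RapidDecay g) (hh : RapidDecay h) : RapidDecay (fun z => g z + h z) := by
  refine ⟨hg.1.add hh.1, fun k => ?_⟩
  obtain ⟨C, hC⟩ := hg.2 k
  obtain ⟨D, hD⟩ := hh.2 k
  refine ⟨C + D, fun z => ?_⟩
  have : |g z + h z| * (1 + ‖z‖) ^ k ≤ (|g z| + |h z|) * (1 + ‖z‖) ^ k := by
    gcongr; exact abs_add_le _ _
  linarith [hC z, hD z]

lemma mul_of_bound (hg : RapidDecay g) {φ : ℂ → ℝ} (hφ : Continuous φ) {C : ℝ}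
    (hbd : ∀ z, |φ z| ≤ C * (1 + ‖z‖)) : RapidDecay (fun z => φ z * g z) := by
  refine ⟨hφ.mul hg.1, fun k => ?_⟩
  obtain ⟨D, hD⟩ := hg.2 (k + 1)
  have hC : 0 ≤ C := by simpa using (abs_nonneg _).trans (hbd 0)
  refine ⟨C * D, fun z => ?_⟩
  calc |φ z * g z| * (1 + ‖z‖) ^ k = |φ z| * (|g z| * (1 + ‖z‖) ^ k) := by rw [abs_mul]; ring
    _ ≤ C * (1 + ‖z‖) * (|g z| * (1 + ‖z‖) ^ k) := by gcongr; exact hbd z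
    _ = C * (|g z| * (1 + ‖z‖) ^ (k + 1)) := by ring
    _ ≤ C * D := by gcongr; exact hD z

end RapidDecay

lemma pow_add_norm_le {a : ℝ} (ha : 0 ≤ a) (z : ℂ) (n : ℕ) :
    (a + ‖z‖) ^ n ≤ (1 + a) ^ n * (1 + ‖z‖) ^ n := by
  rw [← mul_pow]
  gcongr
  nlinarith [norm_nonneg z]

lemma sqrt_norm_sub_sq_le {A : ℝ} (hA : 0 ≤ A) (z w : ℂ) :
    √(‖z - w‖ ^ 2 - A) ≤ ‖w‖ + ‖z‖ := by
  refine (Real.sqrt_le_sqrt (sub_le_self _ hA)).trans ?_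
  rw [Real.sqrt_sq (norm_nonneg _), add_comm]
  exact norm_sub_le z w

lemma sqrt_norm_sub_sq_pow_le {A : ℝ} (hA : 0 ≤ A) (z w : ℂ) (n : ℕ) :
    √(‖z - w‖ ^ 2 - A) ^ n ≤ (1 + ‖w‖) ^ n * (1 + ‖z‖) ^ n :=
  (pow_le_pow_left₀ (Real.sqrt_nonneg _) (sqrt_norm_sub_sq_le hA z w) n).trans
    (pow_add_norm_le (norm_nonneg w) z n)

lemma RapidDecay.integrable_mul_sqrt_pow {g : ℂ → ℝ} (hg : RapidDecay g) {A : ℝ} (hA : 0 ≤ A)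
    (w : ℂ) (n : ℕ) : Integrable (fun z => g z * √(‖z - w‖ ^ 2 - A) ^ n) := by
  refine hg.integrable_mul (by fun_prop) (C := (1 + ‖w‖) ^ n) (k := n) fun z => ?_
  rw [abs_of_nonneg (by positivity)]
  exact sqrt_norm_sub_sq_pow_le hA z w n

/-- Powers of the square root of the positive part, of order at least `3 / 2`, are
continuously differentiable. -/
lemma hasDerivAt_sqrt_pow {n : ℕ} (hn : n ≠ 0) (x : ℝ) :
    HasDerivAt (fun t : ℝ => √t ^ (n + 2)) ((n + 2) / 2 * √x ^ n) x := by
  rcases lt_trichotomy x 0 with hx | rfl | hx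
  · have h0 : (fun t : ℝ => √t ^ (n + 2)) =ᶠ[nhds x] fun _ => 0 := by
      filter_upwards [eventually_lt_nhds hx] with t ht
      simp [Real.sqrt_eq_zero_of_nonpos ht.le]
    simpa [Real.sqrt_eq_zero_of_nonpos hx.le, hn] using
      (hasDerivAt_const x (0 : ℝ)).congr_of_eventuallyEq h0
  · have hmul (t : ℝ) : √t ^ (n + 2) = t * √t ^ n := by
      rcases le_total t 0 with ht | ht
      · simp [Real.sqrt_eq_zero_of_nonpos ht, hn]
      · rw [pow_add, Real.sq_sqrt ht, mul_comm]
    have hc : Continuous fun t : ℝ => √t ^ n := by fun_prop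
    rw [hasDerivAt_iff_tendsto_slope]
    have ht := (hc.tendsto 0).mono_left (nhdsWithin_le_nhds (s := {(0 : ℝ)}ᶜ))
    simp only [Real.sqrt_zero, ne_eq, hn, not_false_eq_true, zero_pow, mul_zero] at ht ⊢
    refine ht.congr' ?_
    filter_upwards [self_mem_nhdsWithin] with t ht
    rw [slope_def_field, hmul, hmul]
    have : t ≠ 0 := ht
    field_simp
    simp
  · refine ((Real.hasDerivAt_sqrt hx.ne').fun_pow (n + 2)).congr_deriv ?_
    have hs : √x ≠ 0 := (Real.sqrt_pos.2 hx).ne'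
    rw [show n + 2 - 1 = n + 1 by omega, pow_succ]
    push_cast
    field_simp

lemma OrthogonalToExteriorPowers.inner_mul {R : ℝ} {g : ℂ → ℝ} (hg : RapidDecay g)
    (h : OrthogonalToExteriorPowers R g) (e : ℂ) :
    OrthogonalToExteriorPowers R (fun z => inner ℝ e z * g z) := by
  intro w n A hn hA
  have hA0 : 0 ≤ A := (sq_nonneg _).trans hA.le
  have hgc := hg.1
  let F : ℝ → ℂ → ℝ := fun ε z => g z * √(‖z - (w + ε • e)‖ ^ 2 - A) ^ (n + 2)
  let F' : ℝ → ℂ → ℝ := fun ε z =>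
    g z * ((n + 2) / 2 * √(‖z - (w + ε • e)‖ ^ 2 - A) ^ n * (2 * inner ℝ (z - (w + ε • e)) (-e)))
  have hF' (z : ℂ) (ε : ℝ) : HasDerivAt (fun t => F t z) (F' ε z) ε := by
    have hlin : HasDerivAt (fun t : ℝ => z - (w + t • e)) (-e) ε := by
      simpa using (((hasDerivAt_id ε).smul_const e).const_add w).const_sub z
    have hsq := (hlin.norm_sq).sub_const A
    exact ((hasDerivAt_sqrt_pow (by omega : n ≠ 0) _).comp ε hsq).const_mul (g z)
  let B : ℝ := ‖w‖ + ‖e‖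
  have hbound (z : ℂ) (ε : ℝ) (hε : ε ∈ Metric.ball (0 : ℝ) 1) :
      ‖F' ε z‖ ≤ (n + 2) * ‖e‖ * (1 + B) ^ (n + 1) * (|g z| * (1 + ‖z‖) ^ (n + 1)) := by
    have hwe : ‖w + ε • e‖ ≤ B := by
      refine (norm_add_le _ _).trans ?_
      rw [norm_smul]
      have : ‖ε‖ ≤ 1 := by simpa using (Metric.mem_ball.1 hε).le
      have := mul_le_mul_of_nonneg_right this (norm_nonneg e)
      simp only [B]
      linarith
    have hs : √(‖z - (w + ε • e)‖ ^ 2 - A) ≤ B + ‖z‖ :=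
      (sqrt_norm_sub_sq_le hA0 z _).trans (by gcongr)
    have hz : ‖z - (w + ε • e)‖ ≤ B + ‖z‖ := by
      refine (norm_sub_le _ _).trans ?_
      linarith
    have hi : |inner ℝ (z - (w + ε • e)) (-e)| ≤ (B + ‖z‖) * ‖e‖ := by
      refine (abs_real_inner_le_norm _ _).trans ?_
      rw [norm_neg]
      gcongr
    have hB : 0 ≤ B := by positivity
    calc ‖F' ε z‖ = |g z| * ((n + 2) / 2 * √(‖z - (w + ε • e)‖ ^ 2 - A) ^ n *
          (2 * |inner ℝ (z - (w + ε • e)) (-e)|)) := by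
          simp only [F', Real.norm_eq_abs, abs_mul, abs_pow, abs_of_nonneg (Real.sqrt_nonneg _)]
          rw [abs_of_nonneg (by positivity : (0 : ℝ) ≤ (n + 2) / 2), abs_two]
      _ ≤ |g z| * ((n + 2) / 2 * (B + ‖z‖) ^ n * (2 * ((B + ‖z‖) * ‖e‖))) := by gcongr
      _ = (n + 2) * ‖e‖ * (|g z| * (B + ‖z‖) ^ (n + 1)) := by ring
      _ ≤ (n + 2) * ‖e‖ * (|g z| * ((1 + B) ^ (n + 1) * (1 + ‖z‖) ^ (n + 1))) := by
          gcongr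
          exact pow_add_norm_le hB z (n + 1)
      _ = _ := by ring
  have hder := hasDerivAt_integral_of_dominated_loc_of_deriv_le (μ := volume) (F := F) (F' := F')
    (Metric.ball_mem_nhds (0 : ℝ) one_pos)
    (.of_forall fun ε => (by fun_prop : Continuous (F ε)).aestronglyMeasurable)
    (hg.integrable_mul_sqrt_pow hA0 _ _)
    (by fun_prop : Continuous (F' 0)).aestronglyMeasurable
    (.of_forall hbound) ((hg.integrable_mul_pow (n + 1)).const_mul _)
    (.of_forall fun z ε _ => hF' z ε)
  have hzero : (fun ε => ∫ z, F ε z) =ᶠ[nhds 0] fun _ => 0 := by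
    have hcont : Continuous fun ε : ℝ => (R + ‖w + ε • e‖) ^ 2 := by fun_prop
    have := hcont.tendsto 0
    simp only [zero_smul, add_zero] at this
    filter_upwards [this.eventually_lt_const hA] with ε hε
    exact h _ _ _ (by omega) hε
  have hint : ∫ z, F' 0 z = 0 :=
    hder.2.unique ((hasDerivAt_const (0 : ℝ) (0 : ℝ)).congr_of_eventuallyEq hzero)
  have hsplit (z : ℂ) : inner ℝ e z * g z * √(‖z - w‖ ^ 2 - A) ^ n =
      (-1 / (n + 2)) * F' 0 z + inner ℝ e w * (g z * √(‖z - w‖ ^ 2 - A) ^ n) := by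
    have : (n : ℝ) + 2 ≠ 0 := by positivity
    simp only [F', zero_smul, add_zero, inner_neg_right, inner_sub_left,
      real_inner_comm e z, real_inner_comm e w]
    field_simp
    ring
  simp_rw [hsplit]
  rw [integral_add (hder.1.const_mul _) ((hg.integrable_mul_sqrt_pow hA0 w n).const_mul _),
    integral_const_mul, integral_const_mul, hint, h w n A hn hA]
  simp

/-- Coordinate polynomials on the plane, as continuous functions. -/
noncomputable def planePolynomials : Subalgebra ℝ C(ℂ, ℝ) :=
  Algebra.adjoin ℝ (Set.range fun e : ℂ => (⟨fun z => inner ℝ e z, by fun_prop⟩ : C(ℂ, ℝ)))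

lemma planePolynomials_separatesPoints : planePolynomials.SeparatesPoints := by
  intro z w hzw
  refine ⟨fun x => inner ℝ (z - w) x, ⟨_, Algebra.subset_adjoin ⟨z - w, rfl⟩, rfl⟩, fun h => ?_⟩
  refine hzw (sub_eq_zero.1 (inner_self_eq_zero (𝕜 := ℝ).1 ?_))
  rw [inner_sub_right]
  exact sub_eq_zero.2 h

lemma OrthogonalToExteriorPowers.polynomial_mul {R : ℝ} {q : C(ℂ, ℝ)}
    (hq : q ∈ planePolynomials) : ∀ {g : ℂ → ℝ}, RapidDecay g → OrthogonalToExteriorPowers R g →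
      RapidDecay (fun z => q z * g z) ∧ OrthogonalToExteriorPowers R (fun z => q z * g z) := by
  induction hq using Algebra.adjoin_induction with
  | mem q hq =>
    obtain ⟨e, rfl⟩ := hq
    intro g hg h
    refine ⟨hg.mul_of_bound (C := ‖e‖) (by fun_prop) fun z => ?_, h.inner_mul hg e⟩
    refine (abs_real_inner_le_norm e z).trans ?_
    gcongr
    linarith
  | algebraMap r =>
    intro g hg h
    refine ⟨hg.mul_of_bound (C := |r|) (by fun_prop) fun z => ?_, fun w n A hn hA => ?_⟩
    · simpa using le_mul_of_one_le_right (abs_nonneg r) (by linarith [norm_nonneg z])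
    · simp [mul_assoc, integral_const_mul, h w n A hn hA]
  | add p q _ _ hp hq =>
    intro g hg h
    obtain ⟨hp1, hp2⟩ := hp hg h
    obtain ⟨hq1, hq2⟩ := hq hg h
    simp only [ContinuousMap.add_apply, add_mul]
    refine ⟨hp1.add hq1, fun w n A hn hA => ?_⟩
    have hA0 : 0 ≤ A := (sq_nonneg _).trans hA.le
    simp only [add_mul]
    rw [integral_add (hp1.integrable_mul_sqrt_pow hA0 w n) (hq1.integrable_mul_sqrt_pow hA0 w n),
      hp2 w n A hn hA, hq2 w n A hn hA, add_zero]
  | mul p q _ _ hp hq =>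
    intro g hg h
    obtain ⟨hq1, hq2⟩ := hq hg h
    simpa only [ContinuousMap.mul_apply, mul_assoc] using hp hq1 hq2

/-- The tent function of the squared modulus with peak at `B` and half-width `d`. -/
noncomputable def tent (B d : ℝ) (z : ℂ) : ℝ :=
  √(‖z‖ ^ 2 - (B - d)) ^ 2 - 2 * √(‖z‖ ^ 2 - B) ^ 2 + √(‖z‖ ^ 2 - (B + d)) ^ 2

lemma sqrt_sq_eq_max (x : ℝ) : √x ^ 2 = max x 0 := by
  rcases le_total x 0 with hx | hx
  · simp [Real.sqrt_eq_zero_of_nonpos hx, hx]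
  · simp [Real.sq_sqrt hx, hx]

lemma continuous_tent (B d : ℝ) : Continuous (tent B d) := by
  unfold tent; fun_prop

lemma tent_nonneg (B : ℝ) {d : ℝ} (hd : 0 ≤ d) (z : ℂ) : 0 ≤ tent B d z := by
  simp only [tent, sqrt_sq_eq_max]
  rcases max_cases (‖z‖ ^ 2 - (B - d)) 0 with h | h <;>
  rcases max_cases (‖z‖ ^ 2 - B) 0 with h' | h' <;>
  rcases max_cases (‖z‖ ^ 2 - (B + d)) 0 with h'' | h'' <;> linarith

lemma tent_eq_zero {B d : ℝ} (hd : 0 ≤ d) {z : ℂ} (hz : B + d ≤ ‖z‖ ^ 2) : tent B d z = 0 := by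
  simp only [tent, sqrt_sq_eq_max]
  rw [max_eq_left (by linarith), max_eq_left (by linarith), max_eq_left (by linarith)]
  ring

lemma tent_peak {d : ℝ} (hd : 0 ≤ d) (z : ℂ) : tent (‖z‖ ^ 2) d z = d := by
  simp only [tent, sqrt_sq_eq_max]
  rw [max_eq_left (by linarith), max_eq_left (by linarith), max_eq_right (by linarith)]
  ring

lemma OrthogonalToExteriorPowers.integral_mul_tent {R : ℝ} {g : ℂ → ℝ}
    (hg : RapidDecay g) (h : OrthogonalToExteriorPowers R g) {B d : ℝ} (hd : 0 ≤ d)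
    (hB : R ^ 2 < B - d) : ∫ z, g z * tent B d z = 0 := by
  have hR2 := sq_nonneg R
  have h0 {A : ℝ} (hA : R ^ 2 < A) : ∫ z, g z * √(‖z‖ ^ 2 - A) ^ 2 = 0 := by
    simpa using h 0 2 A le_rfl (by simpa using hA)
  have hi {A : ℝ} (hA : R ^ 2 < A) : Integrable fun z => g z * √(‖z‖ ^ 2 - A) ^ 2 := by
    simpa using hg.integrable_mul_sqrt_pow (hR2.trans hA.le) 0 2
  have hB1 : R ^ 2 < B := by linarith
  have hB2 : R ^ 2 < B + d := by linarith
  have hsplit (z : ℂ) : g z * tent B d z = g z * √(‖z‖ ^ 2 - (B - d)) ^ 2 -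
      2 * (g z * √(‖z‖ ^ 2 - B) ^ 2) + g z * √(‖z‖ ^ 2 - (B + d)) ^ 2 := by
    simp only [tent]; ring
  simp_rw [hsplit]
  rw [integral_add (f := fun z => g z * √(‖z‖ ^ 2 - (B - d)) ^ 2 -
      2 * (g z * √(‖z‖ ^ 2 - B) ^ 2)) ((hi hB).sub ((hi hB1).const_mul 2)) (hi hB2),
    integral_sub (hi hB) ((hi hB1).const_mul 2), integral_const_mul, h0 hB, h0 hB1, h0 hB2]
  simp

/-- A rapidly decaying function orthogonal to all exterior powers vanishes off the disc. -/
lemma OrthogonalToExteriorPowers.eq_zero {R : ℝ} {g : ℂ → ℝ} (hR : 0 ≤ R) (hg : RapidDecay g)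
    (h : OrthogonalToExteriorPowers R g) {z₀ : ℂ} (hz₀ : R < ‖z₀‖) : g z₀ = 0 := by
  have hgc := hg.1
  obtain ⟨d, hd, hdB⟩ : ∃ d, 0 < d ∧ R ^ 2 < ‖z₀‖ ^ 2 - d := by
    have : R ^ 2 < ‖z₀‖ ^ 2 := by gcongr
    exact ⟨(‖z₀‖ ^ 2 - R ^ 2) / 2, by linarith, by linarith⟩
  set B := ‖z₀‖ ^ 2
  let χ := tent B d
  have hχ : Continuous χ := continuous_tent B d
  have hχ0 : ∀ z, 0 ≤ χ z := tent_nonneg B hd.le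
  let K := Metric.closedBall (0 : ℂ) √(B + d)
  have hK (z : ℂ) (hz : z ∉ K) : χ z = 0 := by
    refine tent_eq_zero hd.le ?_
    simp only [K, Metric.mem_closedBall, dist_zero_right, not_le] at hz
    exact (Real.lt_sq_of_sqrt_lt hz).le
  have hsupp : HasCompactSupport χ := HasCompactSupport.intro (isCompact_closedBall _ _) hK
  have hint {φ : ℂ → ℝ} (hφ : Continuous φ) : Integrable fun z => φ z * χ z :=
    (hφ.mul hχ).integrable_of_hasCompactSupport hsupp.mul_left
  by_contra hne
  have hpos : 0 < ∫ z, g z * g z * χ z := by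
    refine Continuous.integral_pos_of_hasCompactSupport_nonneg_nonzero (x := z₀) (by fun_prop)
      hsupp.mul_left (fun z => mul_nonneg (mul_self_nonneg _) (hχ0 z)) ?_
    have : χ z₀ = d := tent_peak hd.le z₀
    simp [this, hne, hd.ne']
  set M := ∫ z, |g z| * χ z
  have hM : 0 ≤ M := integral_nonneg fun z => mul_nonneg (abs_nonneg _) (hχ0 z)
  obtain ⟨q, hq, hqK⟩ :=
    ContinuousMap.exists_mem_subalgebra_near_continuous_of_isCompact_of_separatesPoints
      planePolynomials_separatesPoints ⟨g, hgc⟩ (isCompact_closedBall (0 : ℂ) √(B + d))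
      (div_pos hpos (by linarith : 0 < M + 1))
  set ε := (∫ z, g z * g z * χ z) / (M + 1) with hε
  obtain ⟨hqg, hqO⟩ := h.polynomial_mul hq hg
  have hq0 := hqO.integral_mul_tent hqg hd.le hdB
  have hle : ∫ z, (g z * g z * χ z - q z * g z * χ z) ≤ ∫ z, ε * (|g z| * χ z) := by
    refine integral_mono ((hint (by fun_prop)).sub (hint (by fun_prop)))
      ((hint (by fun_prop)).const_mul ε) fun z => ?_
    by_cases hz : z ∈ K
    · have h1 : |q z - g z| ≤ ε := (hqK z hz).le
      have h2 : (g z - q z) * g z ≤ ε * |g z| := by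
        refine (le_abs_self _).trans ?_
        rw [abs_mul, abs_sub_comm]
        gcongr
      calc _ = (g z - q z) * g z * χ z := by ring
        _ ≤ ε * |g z| * χ z := mul_le_mul_of_nonneg_right h2 (hχ0 z)
        _ = _ := by ring
    · simp [hK z hz]
  rw [integral_sub (hint (by fun_prop)) (hint (by fun_prop)), hq0, sub_zero,
    integral_const_mul] at hle
  have : (∫ z, g z * g z * χ z) = ε * (M + 1) := by
    rw [hε]; field_simp
  have hε0 : 0 < ε := div_pos hpos (by linarith)
  linarith

lemma integral_sqrt_sub_sq_pow {n : ℕ} (hn : n ≠ 0) (c : ℝ) :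
    ∫ v : ℝ, √(c - v ^ 2) ^ n = √c ^ (n + 1) * ∫ v : ℝ, √(1 - v ^ 2) ^ n := by
  rcases le_or_gt c 0 with hc | hc
  · have (v : ℝ) : √(c - v ^ 2) = 0 := Real.sqrt_eq_zero_of_nonpos (by nlinarith [sq_nonneg v])
    simp [this, Real.sqrt_eq_zero_of_nonpos hc, hn]
  · have hs : 0 < √c := Real.sqrt_pos.2 hc
    have (v : ℝ) : √(c - v ^ 2) ^ n = √c ^ n * √(1 - (v / √c) ^ 2) ^ n := by
      rw [← mul_pow, ← Real.sqrt_mul hc.le, div_pow, Real.sq_sqrt hc.le, mul_sub,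
        mul_div_cancel₀ _ hc.ne', mul_one]
    simp_rw [this]
    rw [integral_const_mul, Measure.integral_comp_div (fun v : ℝ => √(1 - v ^ 2) ^ n),
      abs_of_pos hs, smul_eq_mul]
    ring

lemma integral_sqrt_one_sub_sq_pow_pos {n : ℕ} (hn : n ≠ 0) :
    0 < ∫ v : ℝ, √(1 - v ^ 2) ^ n := by
  refine Continuous.integral_pos_of_hasCompactSupport_nonneg_nonzero (x := 0) (by fun_prop)
    (HasCompactSupport.intro (isCompact_Icc (a := (-1 : ℝ)) (b := 1)) fun v hv => ?_)
    (fun v => by positivity) (by simp)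
  rw [Set.mem_Icc, ← abs_le, not_le] at hv
  rw [Real.sqrt_eq_zero_of_nonpos, zero_pow hn]
  have := (one_lt_sq_iff_one_lt_abs v).2 hv
  linarith

/-- The profile of the ridge functions averaging to exterior powers. -/
noncomputable def ridgeProfile (n : ℕ) (A s : ℝ) : ℝ := |s| * √(s ^ 2 - A) ^ n

lemma continuous_ridgeProfile (n : ℕ) (A : ℝ) : Continuous (ridgeProfile n A) := by
  unfold ridgeProfile; fun_prop

lemma integral_ridgeProfile_cos {n : ℕ} (hn : n ≠ 0) {A r : ℝ} (hA : 0 ≤ A) (hr : 0 ≤ r) :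
    ∫ x in (-(Real.pi / 2))..(Real.pi / 2), ridgeProfile n A (r * Real.cos x) =
      √(r ^ 2 - A) ^ (n + 1) * ∫ v : ℝ, √(1 - v ^ 2) ^ n := by
  have hpi := Real.pi_pos
  have hsub := intervalIntegral.integral_comp_mul_deriv (a := -(Real.pi / 2)) (b := Real.pi / 2)
    (f := fun x => r * Real.sin x) (f' := fun x => r * Real.cos x)
    (g := fun v => √(r ^ 2 - A - v ^ 2) ^ n)
    (fun x _ => (Real.hasDerivAt_sin x).const_mul r) (by fun_prop) (by fun_prop)
  simp only [Real.sin_neg, Real.sin_pi_div_two, mul_neg, mul_one] at hsub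
  rw [← integral_sqrt_sub_sq_pow hn]
  trans ∫ v in (-r)..r, √(r ^ 2 - A - v ^ 2) ^ n
  · rw [← hsub]
    refine intervalIntegral.integral_congr fun x hx => ?_
    rw [Set.uIcc_of_le (by linarith)] at hx
    have hcos : 0 ≤ r * Real.cos x := mul_nonneg hr (Real.cos_nonneg_of_mem_Icc hx)
    have : (r * Real.cos x) ^ 2 - A = r ^ 2 - A - (r * Real.sin x) ^ 2 := by
      rw [mul_pow, mul_pow, Real.cos_sq']; ring
    simp only [ridgeProfile, Function.comp_apply, abs_of_nonneg hcos, this]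
    ring
  · rw [intervalIntegral.integral_of_le (by linarith)]
    refine setIntegral_eq_integral_of_forall_compl_eq_zero fun v hv => ?_
    rw [Real.sqrt_eq_zero_of_nonpos, zero_pow hn]
    have : r ≤ |v| := by
      by_contra! h
      exact hv ⟨(abs_lt.1 h).1, (abs_lt.1 h).2.le⟩
    have := pow_le_pow_left₀ hr this 2
    rw [sq_abs] at this
    linarith

/-- The average of ridge functions over all directions is a radial truncated power. -/
lemma integral_ridgeProfile_re {n : ℕ} (hn : n ≠ 0) {A : ℝ} (hA : 0 ≤ A) (u : ℂ) :
    ∫ θ in (-Real.pi)..Real.pi, ridgeProfile n A (Complex.exp (-θ * Complex.I) * u).re =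
      2 * (∫ v : ℝ, √(1 - v ^ 2) ^ n) * √(‖u‖ ^ 2 - A) ^ (n + 1) := by
  let H : ℝ → ℝ := fun x => ridgeProfile n A (‖u‖ * Real.cos x)
  have hH : Continuous H := (continuous_ridgeProfile n A).comp (by fun_prop)
  have hper : Function.Periodic H Real.pi := fun x => by
    simp [H, ridgeProfile, Real.cos_add_pi]
  have hre (θ : ℝ) : (Complex.exp (-θ * Complex.I) * u).re = ‖u‖ * Real.cos (θ - u.arg) := by
    conv_lhs => rw [← Complex.norm_mul_exp_arg_mul_I u]
    rw [mul_left_comm, ← Complex.exp_add, ← add_mul, Complex.re_ofReal_mul,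
      show -(θ : ℂ) + u.arg = ((-θ + u.arg : ℝ) : ℂ) by push_cast; rfl,
      Complex.exp_ofReal_mul_I_re, ← Real.cos_neg]
    ring_nf
  have hbase (t : ℝ) : ∫ x in t..t + Real.pi, H x =
      √(‖u‖ ^ 2 - A) ^ (n + 1) * ∫ v : ℝ, √(1 - v ^ 2) ^ n := by
    rw [hper.intervalIntegral_add_eq t (-(Real.pi / 2)),
      show -(Real.pi / 2) + Real.pi = Real.pi / 2 by ring]
    exact integral_ridgeProfile_cos hn hA (norm_nonneg u)
  simp_rw [hre]
  rw [intervalIntegral.integral_comp_sub_right H,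
    ← intervalIntegral.integral_add_adjacent_intervals (b := -Real.pi - u.arg + Real.pi)
      (hH.intervalIntegrable _ _) (hH.intervalIntegrable _ _), hbase,
    show Real.pi - u.arg = -Real.pi - u.arg + Real.pi + Real.pi by ring, hbase]
  ring

lemma abs_ridgeProfile_le {A : ℝ} (hA : 0 ≤ A) (n : ℕ) (s : ℝ) :
    |ridgeProfile n A s| ≤ |s| ^ (n + 1) := by
  rw [ridgeProfile, abs_of_nonneg (by positivity), pow_succ' |s|]
  gcongr
  rw [← Real.sqrt_sq_eq_abs]
  exact Real.sqrt_le_sqrt (by linarith)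

lemma integral_rotation (θ : ℝ) (g : ℂ → ℝ) :
    ∫ z, g (Complex.exp (θ * Complex.I) * z) = ∫ z, g z := by
  have := (rotation (Circle.exp θ)).measurePreserving.integral_comp
    (rotation (Circle.exp θ)).toHomeomorph.measurableEmbedding g
  simpa using this

lemma integral_eq_zero_of_forall_vertical {g : ℂ → ℝ}
    (h : ∀ s : ℝ, ∫ t : ℝ, g (s + t * Complex.I) = 0) : ∫ z, g z = 0 := by
  rw [← Complex.volume_preserving_equiv_real_prod.symm.integral_comp' g]
  by_cases hint : Integrable (fun p => g (Complex.measurableEquivRealProd.symm p))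
  · rw [Measure.volume_eq_prod] at hint ⊢
    rw [integral_prod _ hint]
    have (s t : ℝ) : Complex.measurableEquivRealProd.symm (s, t) = s + t * Complex.I := by
      rw [← Complex.mk_eq_add_mul_I]; rfl
    simp [this, h]
  · exact integral_undef hint

lemma integral_mul_ridgeProfile_eq_zero {R : ℝ} {g : ℂ → ℝ}
    (hv : ∀ θ s : ℝ, R < |s| →
      ∫ t : ℝ, g (Complex.exp (θ * Complex.I) * (s + t * Complex.I)) = 0)
    (w : ℂ) {n : ℕ} (hn : n ≠ 0) {A : ℝ} (hA : (R + ‖w‖) ^ 2 < A) (θ : ℝ) :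
    ∫ z, g z * ridgeProfile n A (Complex.exp (-θ * Complex.I) * (z - w)).re = 0 := by
  rw [← integral_rotation θ]
  refine integral_eq_zero_of_forall_vertical fun s => ?_
  set a := (Complex.exp (-θ * Complex.I) * w).re
  have hre (t : ℝ) : (Complex.exp (-θ * Complex.I) *
      (Complex.exp (θ * Complex.I) * (s + t * Complex.I) - w)).re = s - a := by
    rw [mul_sub, ← mul_assoc, ← Complex.exp_add]
    simp [a]
  simp_rw [hre]
  rw [integral_mul_const]
  by_cases hs : R < |s|
  · rw [hv θ s hs, zero_mul]
  · have haw : |a| ≤ ‖w‖ := by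
      refine (Complex.abs_re_le_norm _).trans_eq ?_
      rw [norm_mul, show -(θ : ℂ) = ((-θ : ℝ) : ℂ) by push_cast; rfl,
        Complex.norm_exp_ofReal_mul_I, one_mul]
    have hsa : |s - a| ≤ R + ‖w‖ := (abs_sub _ _).trans (by linarith)
    have := pow_le_pow_left₀ (abs_nonneg _) hsa 2
    rw [sq_abs] at this
    rw [ridgeProfile, Real.sqrt_eq_zero_of_nonpos (by linarith), zero_pow hn, mul_zero, mul_zero]

/-- If the integrals of `g` over all lines missing a disc vanish, then `g` is orthogonal to the
exterior powers. -/
lemma RapidDecay.orthogonalToExteriorPowers {R : ℝ} {g : ℂ → ℝ} (hg : RapidDecay g)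
    (hv : ∀ θ s : ℝ, R < |s| →
      ∫ t : ℝ, g (Complex.exp (θ * Complex.I) * (s + t * Complex.I)) = 0) :
    OrthogonalToExteriorPowers R g := by
  intro w n A hn hA
  obtain ⟨m, rfl⟩ : ∃ m, n = m + 1 := ⟨n - 1, by omega⟩
  have hm : m ≠ 0 := by omega
  have hA0 : 0 ≤ A := (sq_nonneg _).trans hA.le
  have hgc := hg.1
  have hρ := continuous_ridgeProfile m A
  let k : ℂ → ℝ → ℝ := fun z θ =>
    g z * ridgeProfile m A (Complex.exp (-θ * Complex.I) * (z - w)).re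
  have hk : Continuous (Function.uncurry k) := by
    simp only [Function.uncurry_def, k]; fun_prop
  have hint : Integrable (Function.uncurry k)
      (volume.prod (volume.restrict (Set.Ioc (-Real.pi) Real.pi))) := by
    refine (((hg.integrable_mul_pow (m + 1)).const_mul ((1 + ‖w‖) ^ (m + 1))).comp_fst
      (volume.restrict (Set.Ioc (-Real.pi) Real.pi))).mono' hk.aestronglyMeasurable
      (.of_forall fun p => ?_)
    obtain ⟨z, θ⟩ := p
    simp only [Function.uncurry_apply_pair, k, norm_mul, Real.norm_eq_abs]
    have hre : |(Complex.exp (-θ * Complex.I) * (z - w)).re| ≤ ‖w‖ + ‖z‖ := by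
      refine (Complex.abs_re_le_norm _).trans ?_
      rw [norm_mul, show -(θ : ℂ) = ((-θ : ℝ) : ℂ) by push_cast; rfl,
        Complex.norm_exp_ofReal_mul_I, one_mul, add_comm]
      exact norm_sub_le z w
    calc _ ≤ |g z| * (‖w‖ + ‖z‖) ^ (m + 1) := by
          gcongr
          exact (abs_ridgeProfile_le hA0 m _).trans (by gcongr)
      _ ≤ |g z| * ((1 + ‖w‖) ^ (m + 1) * (1 + ‖z‖) ^ (m + 1)) := by
          gcongr
          exact pow_add_norm_le (norm_nonneg w) z (m + 1)
      _ = _ := by ring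
  have hswap := integral_integral_swap hint
  have hleft (z : ℂ) : ∫ θ in Set.Ioc (-Real.pi) Real.pi, k z θ =
      2 * (∫ v : ℝ, √(1 - v ^ 2) ^ m) * (g z * √(‖z - w‖ ^ 2 - A) ^ (m + 1)) := by
    rw [← intervalIntegral.integral_of_le (by linarith [Real.pi_pos]),
      intervalIntegral.integral_const_mul, integral_ridgeProfile_re hm hA0]
    ring
  have hright (θ : ℝ) : ∫ z, k z θ = 0 :=
    integral_mul_ridgeProfile_eq_zero hv w hm hA θ
  simp only [hleft, hright, integral_const_mul, integral_zero] at hswap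
  have := integral_sqrt_one_sub_sq_pow_pos hm
  exact (mul_eq_zero.1 hswap).resolve_left (by positivity)

/-- In a finite-dimensional space the convex hull of a compact set is compact. -/
lemma IsCompact.isCompact_convexHull {E : Type*} [NormedAddCommGroup E] [NormedSpace ℝ E]
    [FiniteDimensional ℝ E] {s : Set E} (hs : IsCompact s) : IsCompact (convexHull ℝ s) := by
  let comb (n : ℕ) : (Fin n → ℝ) × (Fin n → E) → E := fun p => ∑ i, p.1 i • p.2 i
  have hunion : convexHull ℝ s = ⋃ n ∈ Finset.range (Module.finrank ℝ E + 2),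
      comb n '' (stdSimplex ℝ (Fin n) ×ˢ Set.univ.pi fun _ => s) := by
    ext x
    simp only [Set.mem_iUnion, exists_prop, Finset.mem_range]
    constructor
    · intro hx
      obtain ⟨ι, _, z, w, hz, haff, hw0, hw1, hx⟩ := eq_pos_convex_span_of_mem_convexHull hx
      let e := Fintype.equivFin ι
      have hcard : Fintype.card ι ≤ Module.finrank ℝ E + 1 :=
        haff.card_le_finrank_succ.trans (by gcongr; exact Submodule.finrank_le _)
      refine ⟨Fintype.card ι, by omega, (w ∘ e.symm, z ∘ e.symm),
        ⟨⟨fun i => (hw0 _).le, ?_⟩, fun i _ => hz ⟨_, rfl⟩⟩, ?_⟩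
      · rw [← hw1]; exact e.symm.sum_comp w
      · rw [← hx]; exact e.symm.sum_comp fun i => w i • z i
    · rintro ⟨n, -, ⟨w, z⟩, ⟨hw, hz⟩, rfl⟩
      exact (convex_convexHull ℝ s).sum_mem (fun i _ => hw.1 i) hw.2
        fun i _ => subset_convexHull ℝ s (hz i trivial)
  rw [hunion]
  exact Finset.isCompact_biUnion _ fun n _ =>
    ((isCompact_stdSimplex ℝ (Fin n)).prod (isCompact_univ_pi fun _ => hs)).image
      (by simp only [comb]; fun_prop)

/-- A point outside a compact convex set is separated from it by a ball. -/
lemma exists_closedBall_of_notMem_convex {E : Type*} [NormedAddCommGroup E]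
    [InnerProductSpace ℝ E] [CompleteSpace E] [Nontrivial E] {s : Set E}
    (hs : IsCompact s) (hconv : Convex ℝ s) {x : E} (hx : x ∉ s) :
    ∃ (c : E) (R : ℝ), 0 ≤ R ∧ s ⊆ Metric.closedBall c R ∧ R < ‖x - c‖ := by
  rcases s.eq_empty_or_nonempty with rfl | hne
  · obtain ⟨c, hc⟩ := exists_ne x
    exact ⟨c, 0, le_rfl, Set.empty_subset _, norm_pos_iff.2 (sub_ne_zero.2 hc.symm)⟩
  obtain ⟨φ, u, hxu, hu⟩ := geometric_hahn_banach_point_closed hconv hs.isClosed hx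
  let v := (InnerProductSpace.toDual ℝ E).symm φ
  have hv (y : E) : inner ℝ v y = φ y := InnerProductSpace.toDual_symm_apply
  obtain ⟨D, hD⟩ := hs.isBounded.subset_closedBall x
  let δ := u - φ x
  have hδ : 0 < δ := sub_pos.2 hxu
  let l := (D ^ 2 + 1) / δ
  have hl : 0 < l := by positivity
  have hlδ : l * δ = D ^ 2 + 1 := by simp only [l]; field_simp
  let c := x + l • v
  have hc : ‖x - c‖ ^ 2 = l ^ 2 * ‖v‖ ^ 2 := by
    simp [c, norm_smul, mul_pow]
  have hsc {y : E} (hy : y ∈ s) : ‖y - c‖ ^ 2 < ‖x - c‖ ^ 2 := by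
    have h1 : ‖y - x‖ ^ 2 ≤ D ^ 2 := by
      have := hD hy
      rw [Metric.mem_closedBall, dist_eq_norm] at this
      gcongr
    have h2 : δ ≤ inner ℝ v (y - x) := by
      rw [hv, map_sub]
      simp only [δ]
      linarith [hu y hy]
    have h3 : y - c = (y - x) - l • v := by simp only [c]; abel
    rw [hc, h3, norm_sub_sq_real, norm_smul, mul_pow, inner_smul_right, real_inner_comm,
      Real.norm_eq_abs, sq_abs]
    nlinarith
  obtain ⟨y, hy, hmax⟩ := hs.exists_isMaxOn hne (f := fun y => ‖y - c‖) (by fun_prop)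
  refine ⟨c, ‖y - c‖, norm_nonneg _, fun z hz => ?_,
    lt_of_pow_lt_pow_left₀ 2 (norm_nonneg _) (hsc hy)⟩
  rw [Metric.mem_closedBall, dist_eq_norm]
  exact hmax hz

/-- **Support theorem on `ℝ²` for general compact sets.**
If `f : ℝ² → ℝ` is continuous with rapid decay and its X-ray transform vanishes
on every line `x + ℝθ` disjoint from a compact set `K₀`, then `f` vanishes on the
complement of the convex hull of `K₀`. -/
theorem xray_support_theorem_compact_set
    (K₀ : Set (EuclideanSpace ℝ (Fin 2))) (hK₀ : IsCompact K₀)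
    (f : EuclideanSpace ℝ (Fin 2) → ℝ)
    (hf : Continuous f)
    (hdecay : ∀ k : ℕ, ∃ C : ℝ, ∀ x : EuclideanSpace ℝ (Fin 2),
      |f x| ≤ C / (1 + ‖x‖) ^ k)
    (hvanish : ∀ (x θ : EuclideanSpace ℝ (Fin 2)), ‖θ‖ = 1 →
      (∀ s : ℝ, x + s • θ ∉ K₀) → ∫ s : ℝ, f (x + s • θ) = 0) :
    ∀ x : EuclideanSpace ℝ (Fin 2), x ∉ convexHull ℝ K₀ → f x = 0 := by
  intro x hx
  obtain ⟨c, R, hR, hKR, hxR⟩ := exists_closedBall_of_notMem_convex hK₀.isCompact_convexHull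
    (convex_convexHull ℝ K₀) hx
  let e : ℂ ≃ₗᵢ[ℝ] EuclideanSpace ℝ (Fin 2) := Complex.orthonormalBasisOneI.repr
  let g : ℂ → ℝ := fun z => f (c + e z)
  have hg : RapidDecay g := by
    refine ⟨by fun_prop, fun k => ?_⟩
    obtain ⟨C, hC⟩ := hdecay k
    refine ⟨C * (1 + ‖c‖) ^ k, fun z => ?_⟩
    have h1 : 1 + ‖z‖ ≤ (1 + ‖c‖) * (1 + ‖c + e z‖) := by
      have : ‖e z‖ ≤ ‖c + e z‖ + ‖c‖ := by
        simpa using norm_sub_le (c + e z) c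
      rw [e.norm_map] at this
      nlinarith [norm_nonneg c, norm_nonneg (c + e z)]
    have h2 : |g z| * (1 + ‖c + e z‖) ^ k ≤ C := (le_div_iff₀ (by positivity)).1 (hC _)
    calc |g z| * (1 + ‖z‖) ^ k ≤ |g z| * ((1 + ‖c‖) * (1 + ‖c + e z‖)) ^ k := by gcongr
      _ = |g z| * (1 + ‖c + e z‖) ^ k * (1 + ‖c‖) ^ k := by rw [mul_pow]; ring
      _ ≤ C * (1 + ‖c‖) ^ k := by gcongr
  have hv (θ s : ℝ) (hs : R < |s|) :
      ∫ t : ℝ, g (Complex.exp (θ * Complex.I) * (s + t * Complex.I)) = 0 := by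
    let ω := Complex.exp (θ * Complex.I)
    have hline (t : ℝ) : c + e (ω * (s + t * Complex.I)) =
        c + e (ω * s) + t • e (ω * Complex.I) := by
      rw [add_assoc, ← map_smul, ← map_add, Complex.real_smul]
      ring_nf
    have hω : ‖ω‖ = 1 := Complex.norm_exp_ofReal_mul_I θ
    simp only [g, ω, hline]
    refine hvanish _ _ (by simp) fun t ht => ?_
    have := hKR (subset_convexHull ℝ K₀ ht)
    rw [← hline, Metric.mem_closedBall, dist_eq_norm, add_sub_cancel_left, e.norm_map, norm_mul,
      hω, one_mul] at this
    have hre : |s| ≤ ‖(s : ℂ) + t * Complex.I‖ := by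
      simpa using Complex.abs_re_le_norm ((s : ℂ) + t * Complex.I)
    linarith
  have h0 := (hg.orthogonalToExteriorPowers hv).eq_zero hR hg (z₀ := e.symm (x - c))
    (by rwa [e.symm.norm_map])
  simpa [g] using h0
end
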